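/- Let d ≥ 1 and f : F_2^{d+1} → F_2 be given by f(x_1,...,x_{d+1}) = x_1 ⊕ x_2·x_3···x_d·(x_{d+1} ⊕ 1). For n > d, let F : F_2^n → F_2^n be the cyclic induced map and ι(n) = |{y ∈ F_2^n : F^{-1}(y) = ∅}|. Then ι(n) = d·2^{n/d − 1} if d divides n, and ι(n) = 0 otherwise. -/

import Mathlib

/-- The cyclic (shift-invariant, periodic boundary) map on `n` bits induced by a
Boolean function `f` on `k` bits. -/
def cyc {k n : ℕ} (f : (Fin k → Bool) → Bool) (x : Fin n → Bool) : Fin n → Bool :=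
  fun i => f fun j => x ⟨(i.val + j.val) % n, Nat.mod_lt _ i.pos⟩

/-- The non-wrapping induced map `F_{(m)} : F_2^m → F_2^{m-k+1}`. -/
def ncyc {k m : ℕ} (hk : k ≤ m) (f : (Fin k → Bool) → Bool) (x : Fin m → Bool) :
    Fin (m - k + 1) → Bool :=
  fun i => f fun j => x ⟨i.val + j.val, by have h1 := i.isLt; have h2 := j.isLt; omega⟩
/-- `f(x₁,…,x_{d+1}) = x₁ ⊕ x₂⋯x_d·(x_{d+1} ⊕ 1)`. -/
def chiGen (d : ℕ) : (Fin (d + 1) → Bool) → Bool :=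
  fun x => xor (x 0)
    ((decide (∀ j : Fin (d + 1), 0 < j.val → j.val < d → x j = true))
      && !(x ⟨d, Nat.lt_succ_self d⟩))

/-- The monomial `x_{i+1}⋯x_{i+d-1}(x_{i+d} ⊕ 1)` on bi-infinite sequences, as a proposition. -/
def PX (d : ℕ) (X : ℤ → Bool) (i : ℤ) : Prop :=
  (∀ j : ℕ, 0 < j → j < d → X (i + j) = true) ∧ X (i + d) = false

/-- `X` is a preimage of `Y`. -/
def Pre (d : ℕ) (X Y : ℤ → Bool) : Prop :=
  ∀ i, (Y i = false ↔ (X i = false ↔ ¬ PX d X i))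

/-- One step of the automaton. -/
def stepT (d : ℕ) (b : Bool) (s : ℕ) : ℕ :=
  if b = false then (if s = d then d + 1 else 1)
  else if s = d then 1 else if s < d then s + 1 else d + 1

/-- Run of the automaton. -/
def runT (d : ℕ) (z : ℕ → Bool) (s : ℕ) : ℕ → ℕ
  | 0 => s
  | t + 1 => stepT d (z t) (runT d z s t)

lemma run_inv (d n : ℕ) (hd : 1 ≤ d) (z : ℕ → Bool)
    (hne : runT d z 1 n ≠ runT d z (d + 1) n) (t : ℕ) (ht : t ≤ n) :
    (∀ u, u < t → z u = false → d ∣ u + 1) ∧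
    (Odd ((Finset.range t).filter fun u => z u = false).card →
      runT d z 1 t = d + 1 ∧ runT d z (d + 1) t = 1 + t % d) ∧
    (¬ Odd ((Finset.range t).filter fun u => z u = false).card →
      runT d z 1 t = 1 + t % d ∧ runT d z (d + 1) t = d + 1) := by
  have hall : ∀ t, t ≤ n → runT d z 1 t ≠ runT d z (d + 1) t := by
    clear ht t
    intro t ht he
    apply hne
    obtain ⟨k, rfl⟩ := Nat.exists_eq_add_of_le ht
    clear hne ht
    induction k with
    | zero => exact he
    | succ k ih => rw [← Nat.add_assoc]; simp only [runT]; rw [ih]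
  induction t with
  | zero => simp [runT]
  | succ t ih =>
    obtain ⟨h1, h2, h3⟩ := ih (by omega)
    have hx := hall (t + 1) ht
    have hlt : t % d < d := Nat.mod_lt _ hd
    have hm : (1 + t % d = d → (t + 1) % d = 0) ∧
        (1 + t % d ≠ d → (t + 1) % d = t % d + 1) := by
      constructor
      · intro h
        rw [Nat.add_mod_eq_ite]
        rcases Nat.lt_or_ge 1 d with h' | h'
        · rw [Nat.mod_eq_of_lt h']; split_ifs <;> omega
        · have : d = 1 := by omega
          subst this; split_ifs <;> omega
      · intro h
        rw [Nat.add_mod_eq_ite]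
        have h' : 1 < d := by omega
        rw [Nat.mod_eq_of_lt h']; split_ifs <;> omega
    rw [Finset.range_add_one, Finset.filter_insert]
    simp only [runT] at hx ⊢
    by_cases hz : z t = false
    · simp only [hz, if_true]
      rw [Finset.card_insert_of_notMem (by simp)]
      have hs : 1 + t % d = d := by
        by_contra hs
        apply hx
        by_cases ho : Odd ((Finset.range t).filter fun u => z u = false).card
        · obtain ⟨e1, e2⟩ := h2 ho
          rw [e1, e2]; simp [stepT, hz, hs]
        · obtain ⟨e1, e2⟩ := h3 ho
          rw [e1, e2]; simp [stepT, hz, hs]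
      have hm0 := hm.1 hs
      refine ⟨?_, ?_, ?_⟩
      · intro u hu hzu
        rcases Nat.lt_succ_iff_lt_or_eq.mp hu with h | h
        · exact h1 u h hzu
        · subst h; exact Nat.dvd_of_mod_eq_zero hm0
      · intro ho
        obtain ⟨e1, e2⟩ := h3 (by rw [Nat.odd_add_one] at ho; exact ho)
        rw [e1, e2]; simp [stepT, hs, hm0]
      · intro ho
        obtain ⟨e1, e2⟩ := h2 (by rw [Nat.odd_add_one] at ho; exact not_not.mp ho)
        rw [e1, e2]; simp [stepT, hs, hm0]
    · simp only [hz]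
      have hz' : z t = true := by simpa using hz
      refine ⟨?_, ?_, ?_⟩
      · intro u hu hzu
        rcases Nat.lt_succ_iff_lt_or_eq.mp hu with h | h
        · exact h1 u h hzu
        · subst h; exact absurd hzu hz
      · intro ho
        obtain ⟨e1, e2⟩ := h2 ho
        rw [e1, e2]; simp only [stepT]; refine ⟨by simp, ?_⟩
        by_cases hs : 1 + t % d = d
        · simp [hs, hm.1 hs]
        · have : 1 + t % d < d := by omega
          simp [hs, hm.2 hs, this]; omega
      · intro ho
        obtain ⟨e1, e2⟩ := h3 ho
        rw [e1, e2]; simp only [stepT]; refine ⟨?_, by simp⟩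
        by_cases hs : 1 + t % d = d
        · simp [hs, hm.1 hs]
        · have : 1 + t % d < d := by omega
          simp [hs, hm.2 hs, this]; omega

/-- periodic state sequence gives a preimage -/
lemma state_pre (d : ℕ) (hd : 1 ≤ d) (Y : ℤ → Bool) (S : ℤ → ℕ) (hS : ∀ i, 1 ≤ S i)
    (hrec : ∀ i, S (i - 1) = stepT d (Y i) (S i)) :
    Pre d (fun i => xor (Y i) (decide (S i = d))) Y := by
  set X : ℤ → Bool := fun i => xor (Y i) (decide (S i = d)) with hX
  have hrec' : ∀ i, S i = if X (i + 1) = false then 1 else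
      if S (i + 1) < d then S (i + 1) + 1 else d + 1 := by
    intro i
    have := hrec (i + 1)
    rw [add_sub_cancel_right] at this
    rw [this]
    simp only [hX, stepT]
    cases Y (i + 1) <;> by_cases h : S (i + 1) = d <;> simp [h]
  have key : ∀ j : ℕ, 1 ≤ j → j ≤ d → ∀ i, S i = j ↔
      ((∀ k : ℕ, 0 < k → k < j → X (i + k) = true) ∧ X (i + j) = false) := by
    intro j hj
    induction j, hj using Nat.le_induction with
    | base =>
      intro h1 i
      rw [hrec' i]
      have := hS (i + 1)
      constructor
      · intro h
        refine ⟨fun k _ _ => by omega, ?_⟩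
        by_contra hc
        push_cast at hc
        rw [if_neg hc] at h
        split_ifs at h <;> omega
      · rintro ⟨_, h⟩
        push_cast at h
        rw [if_pos h]
    | succ j hj ih =>
      intro h1 i
      have ih' := ih (by omega) (i + 1)
      rw [hrec' i]
      constructor
      · intro h
        have hc : ¬ X (i + 1) = false := by
          intro hc; rw [if_pos hc] at h; omega
        rw [if_neg hc] at h
        have hs : S (i + 1) = j := by split_ifs at h <;> omega
        obtain ⟨a, b⟩ := ih'.1 hs
        refine ⟨?_, by rw [← b]; congr 1; push_cast; ring⟩
        intro k hk hkj
        rcases Nat.lt_or_ge 1 k with h' | h'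
        · rw [← a (k - 1) (by omega) (by omega)]; congr 1; push_cast [Nat.cast_sub h'.le]; ring
        · have : k = 1 := by omega
          subst this; simpa using hc
      · rintro ⟨a, b⟩
        have hc := a 1 (by omega) (by omega)
        push_cast at hc
        have hs : S (i + 1) = j := by
          rw [ih']
          refine ⟨fun k hk hkj => ?_, by rw [← b]; congr 1; push_cast; ring⟩
          rw [← a (k + 1) (by omega) (by omega)]; congr 1; push_cast; ring
        rw [hc, hs, if_neg (by simp), if_pos (by omega)]
  intro i
  have hk := key d hd le_rfl i
  have : PX d X i ↔ S i = d := hk.symm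
  rw [this]
  simp only [hX]
  by_cases h : S i = d <;> cases Y i <;> simp [h]

/-- Existence of a preimage outside of the exceptional set. -/
lemma exists_pre (d n : ℕ) (hd : 1 ≤ d) (hn : 0 < n) (Y : ℤ → Bool)
    (hY : ∀ i, Y (i + n) = Y i) (p : ℤ) (hp : Y p = false)
    (hno : ∀ X : ℤ → Bool, (∀ i, X (i + n) = X i) → ¬ Pre d X Y) :
    (∀ u : ℕ, u < n → Y (p - 1 - u) = false → d ∣ u + 1) ∧
    Odd ((Finset.range n).filter fun u : ℕ => Y (p - 1 - u) = false).card := by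
  set z : ℕ → Bool := fun u => Y (p - 1 - u) with hz
  have hfix : ∀ s, 1 ≤ s → runT d z s n ≠ s := by
    intro s hs he
    have hpos : ∀ t, 1 ≤ runT d z s t := by
      intro t
      cases t with
      | zero => exact hs
      | succ t => simp only [runT, stepT]; split_ifs <;> omega
    set S : ℤ → ℕ := fun i => runT d z s ((p - 1 - i) % n).toNat with hSd
    have hper : ∀ i, S (i + n) = S i := by
      intro i
      simp only [hSd]
      congr 2
      rw [← Int.sub_sub, Int.sub_emod_right]
    refine hno (fun i => xor (Y i) (decide (S i = d))) (fun i => by simp only [hY, hper]) 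
      (state_pre d hd Y S (fun i => hpos _) ?_)
    intro i
    simp only [hSd]
    have hn0 : (n : ℤ) ≠ 0 := by omega
    obtain ⟨t, ht⟩ : ∃ t : ℕ, (p - 1 - i) % n = t := 
      ⟨_, (Int.toNat_of_nonneg (Int.emod_nonneg _ hn0)).symm⟩
    have htn : (t : ℤ) < n := by rw [← ht]; exact Int.emod_lt_of_pos _ (by omega)
    have hzt : z t = Y i := by
      simp only [hz]
      have h1 : p - 1 - t = i + n * ((p - 1 - i) / n) := by
        have := Int.emod_add_mul_ediv (p - 1 - i) n
        rw [ht] at this; linarith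
      rw [h1, mul_comm]
      exact (Function.Periodic.int_mul (f := Y) hY _) i
    have h2 : (p - 1 - (i - 1)) % n = ((t : ℤ) + 1) % n := by
      rw [← ht, Int.emod_add_emod]; congr 1; ring
    rw [h2, ht]
    by_cases hlast : t + 1 = n
    · have : ((t : ℤ) + 1) % n = 0 := by rw [← hlast]; push_cast; simp
      rw [this, ← hzt]
      simp only [Int.toNat_zero, Int.toNat_natCast]
      change s = runT d z s (t + 1)
      rw [hlast, he]
    · rw [Int.emod_eq_of_lt (by omega) (by omega), ← hzt]
      have : ((t : ℤ) + 1).toNat = t + 1 := by omega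
      rw [this]; simp [runT]
  have hz0 : z (n - 1) = false := by
    simp only [hz]
    rw [← hp, ← hY]; congr 1; push_cast [Nat.cast_sub hn]; ring
  have hres : ∀ s, runT d z s n = 1 ∨ runT d z s n = d + 1 := by
    intro s
    obtain ⟨m, rfl⟩ : ∃ m, n = m + 1 := ⟨n - 1, by omega⟩
    simp only [runT]
    simp only [Nat.add_sub_cancel] at hz0
    simp only [stepT, hz0]
    split_ifs <;> simp
  have e1 : runT d z 1 n = d + 1 := (hres 1).resolve_left (hfix 1 le_rfl)
  have e2 : runT d z (d + 1) n = 1 := (hres (d + 1)).resolve_right (hfix (d + 1) (by omega))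
  obtain ⟨h1, h2, h3⟩ := run_inv d n hd z (by omega) n le_rfl
  refine ⟨h1, ?_⟩
  by_contra ho
  have := (h3 ho).2
  omega

/-- Non-existence of a preimage on the exceptional set. -/
lemma no_pre (d m : ℕ) (X Y : ℤ → Bool)
    (hX : ∀ i, X (i + (d * m : ℕ)) = X i) (r : ℤ)
    (hz : ∀ i, Y i = false → (d : ℤ) ∣ i - r) (hpre : Pre d X Y) :
    ¬ Odd ((Finset.range m).filter fun k : ℕ => Y (r + d * k) = false).card := by
  have hstep : ∀ i, (d : ℤ) ∣ i - r → (PX d X (i - d) ↔ X i = false) := by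
    intro i hi
    constructor
    · rintro ⟨_, h⟩; simpa using h
    · intro h
      refine ⟨?_, by simpa using h⟩
      intro j hj hjd
      have hYj : Y (i - d + j) ≠ false := by
        intro hc
        have h1 := hz _ hc
        have h2 : (d : ℤ) ∣ j := by
          have := dvd_sub h1 hi
          have h3 : i - d + j - r - (i - r) = j - d := by ring
          rw [h3] at this
          exact (dvd_sub_self_right).mp this
        have := Int.le_of_dvd (by omega) h2
        omega
      have hP : ¬ PX d X (i - d + j) := by
        rintro ⟨a, b⟩
        have := a (d - j) (by omega) (by omega)
        rw [Nat.cast_sub hjd.le] at this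
        have e : i - d + j + ((d : ℤ) - j) = i := by ring
        rw [e, h] at this
        simp at this
      have := hpre (i - d + j)
      by_contra hc
      simp only [Bool.not_eq_true] at hc
      exact hYj (this.2 ⟨fun _ => hP, fun _ => hc⟩)
  have hq : ∀ k : ℕ, (PX d X (r + d * k - d) ↔
      (PX d X (r - d) ↔ ¬ Odd ((Finset.range k).filter fun k : ℕ => Y (r + d * k) = false).card)) := by
    intro k
    induction k with
    | zero => simp
    | succ k ih =>
      have e : r + d * ((k + 1 : ℕ) : ℤ) - d = r + d * k := by push_cast; ring
      rw [e]
      have h1 := hstep (r + d * k) (by simp)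
      have h2 := hpre (r + d * k)
      rw [Finset.range_add_one, Finset.filter_insert]
      split_ifs with hy
      · rw [Finset.card_insert_of_notMem (by simp), Nat.odd_add_one]
        tauto
      · tauto
  have hm := hq m
  have : PX d X (r + d * m - d) ↔ PX d X (r - d) := by
    have e : ∀ j : ℤ, X (r + d * m - d + j) = X (r - d + j) := by
      intro j
      rw [← hX (r - d + j)]; congr 1; push_cast; ring
    simp only [PX, e]
  tauto

/-- Periodic extension. -/
def extZ {n : ℕ} (hn : 0 < n) (y : Fin n → Bool) (i : ℤ) : Bool :=
  y ⟨(i % n).toNat, by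
    have := Int.emod_lt_of_pos i (show (0 : ℤ) < n by omega)
    have := Int.emod_nonneg i (show (n : ℤ) ≠ 0 by omega)
    omega⟩

lemma extZ_per {n : ℕ} (hn : 0 < n) (y : Fin n → Bool) (i : ℤ) :
    extZ hn y (i + n) = extZ hn y i := by
  simp only [extZ, Int.add_emod_right]

lemma extZ_nat {n : ℕ} (hn : 0 < n) (y : Fin n → Bool) (i : ℕ) (hi : i < n) :
    extZ hn y (i : ℤ) = y ⟨i, hi⟩ := by
  simp only [extZ]
  congr 2
  rw [Int.emod_eq_of_lt (by omega) (by omega)]; simp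

lemma per_emod {n : ℕ} (Y : ℤ → Bool) (hY : ∀ i, Y (i + n) = Y i) (i : ℤ) :
    Y (i % n) = Y i := by
  have h1 : i = i % n + (i / n) * n := by
    have := Int.emod_add_mul_ediv i n
    linarith
  conv_rhs => rw [h1]
  exact ((Function.Periodic.int_mul (f := Y) hY _) _).symm

lemma cyc_iff (d n : ℕ) (hn : 0 < n) (x y : Fin n → Bool) :
    cyc (chiGen d) x = y ↔ Pre d (extZ hn x) (extZ hn y) := by
  have h : ∀ i : Fin n, (cyc (chiGen d) x i = y i ↔
      (extZ hn y i = false ↔ (extZ hn x i = false ↔ ¬ PX d (extZ hn x) i))) := by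
    intro i
    have hx : ∀ j : ℕ, x ⟨(i.val + j) % n, Nat.mod_lt _ hn⟩ = extZ hn x ((i : ℤ) + j) := by
      intro j
      simp only [extZ]
      congr 2
    have hx0 := hx 0
    simp only [Nat.cast_zero, add_zero] at hx0
    have hP : PX d (extZ hn x) i ↔ 
        ((decide (∀ j : Fin (d + 1), 0 < j.val → j.val < d → 
          x ⟨(i.val + j.val) % n, Nat.mod_lt _ hn⟩ = true))
      && !(x ⟨(i.val + d) % n, Nat.mod_lt _ hn⟩)) = true := by
      simp only [PX, hx, Bool.and_eq_true, decide_eq_true_eq, Bool.not_eq_true']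
      constructor
      · rintro ⟨a, b⟩
        exact ⟨fun j h1 h2 => a j h1 h2, b⟩
      · rintro ⟨a, b⟩
        exact ⟨fun j h1 h2 => a ⟨j, by omega⟩ h1 h2, b⟩
    rw [hP, extZ_nat hn y i i.isLt]
    simp only [cyc, chiGen, Fin.val_zero, Nat.add_zero]
    rw [← hx0]
    generalize (decide (∀ j : Fin (d + 1), 0 < j.val → j.val < d → 
          x ⟨(i.val + j.val) % n, Nat.mod_lt _ hn⟩ = true)
      && !(x ⟨(i.val + d) % n, Nat.mod_lt _ hn⟩)) = b
    generalize x ⟨i.val % n, _⟩ = a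
    simp only [Fin.eta]
    generalize y i = c
    revert a b c; decide
  constructor
  · intro he i
    have h1 := Int.emod_lt_of_pos i (show (0 : ℤ) < n by omega)
    have h2 := Int.emod_nonneg i (show (n : ℤ) ≠ 0 by omega)
    have := (h ⟨(i % n).toNat, by omega⟩).1 (by rw [he])
    simp only [Int.toNat_of_nonneg h2] at this
    rw [per_emod _ (extZ_per hn y), per_emod _ (extZ_per hn x)] at this
    rw [this]
    have e : ∀ j : ℤ, extZ hn x (i % n + j) = extZ hn x (i + j) := by
      intro j
      simp only [extZ, Int.emod_add_emod]
    simp only [PX, e]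
  · intro he
    funext i
    exact (h i).2 (he i)

/-- The exceptional set. -/
def Bad (d m : ℕ) (Y : ℤ → Bool) (r : ℕ) : Prop :=
  (∀ i, Y i = false → (d : ℤ) ∣ i - r) ∧
    Odd ((Finset.range m).filter fun k : ℕ => Y (r + d * k) = false).card

lemma bad_of_no (d n : ℕ) (hd : 1 ≤ d) (hn : d < n) (Y : ℤ → Bool)
    (hY : ∀ i, Y (i + n) = Y i)
    (hno : ∀ X : ℤ → Bool, (∀ i, X (i + n) = X i) → ¬ Pre d X Y) :
    ∃ m, n = d * m ∧ ∃ r < d, Bad d m Y r := by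
  have hn0 : 0 < n := by omega
  by_cases hall : ∀ i, Y i = true
  · exfalso
    refine hno (fun _ => true) (fun _ => rfl) ?_
    intro i; simp [hall, PX]
  push Not at hall
  obtain ⟨p, hp⟩ := hall
  simp only [ne_eq, Bool.not_eq_true] at hp
  obtain ⟨h1, h2⟩ := exists_pre d n hd hn0 Y hY p hp hno
  have hdn : d ∣ n := by
    have := h1 (n - 1) (by omega) (by
      rw [← hp, ← hY]; congr 1; push_cast [Nat.cast_sub hn0]; ring)
    rwa [Nat.sub_add_cancel hn0] at this
  obtain ⟨m, rfl⟩ := hdn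
  have hdn' : (d : ℤ) ∣ ((d * m : ℕ) : ℤ) := by push_cast; exact dvd_mul_right _ _
  have hd0 : (0 : ℤ) < d := by omega
  have hnz : (0 : ℤ) < ((d * m : ℕ) : ℤ) := by exact_mod_cast hn0
  have hzz : ∀ i, Y i = false → (d : ℤ) ∣ i - p := by
    intro i hi
    have a1 := Int.emod_lt_of_pos (p - 1 - i) hnz
    have a2 := Int.emod_nonneg (p - 1 - i) hnz.ne'
    have a3 := Int.emod_add_mul_ediv (p - 1 - i) ((d * m : ℕ) : ℤ)
    set q := (p - 1 - i) / ((d * m : ℕ) : ℤ)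
    obtain ⟨u, hu⟩ := Int.eq_ofNat_of_zero_le a2
    rw [hu] at a1 a3
    have a4 := h1 u (by exact_mod_cast a1) (by
      have e : p - 1 - u = i + q * ((d * m : ℕ) : ℤ) := by linarith
      rw [e, ← hi]
      exact (Function.Periodic.int_mul (f := Y) hY _) i)
    have a5 : (d : ℤ) ∣ (u : ℤ) + 1 := by exact_mod_cast a4
    have e : i - p = -((u : ℤ) + 1) - ((d * m : ℕ) : ℤ) * q := by linarith
    rw [e]
    exact dvd_sub (dvd_neg.2 a5) (hdn'.mul_right _)
  obtain ⟨r, hr⟩ := Int.eq_ofNat_of_zero_le (Int.emod_nonneg p hd0.ne')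
  have hrd : r < d := by
    have := Int.emod_lt_of_pos p hd0
    omega
  have hpr : (d : ℤ) ∣ p - r := by rw [← hr]; exact Int.dvd_self_sub_emod
  refine ⟨m, rfl, r, hrd, ?_, ?_⟩
  · intro i hi
    have := dvd_add (hzz i hi) hpr
    rwa [sub_add_sub_cancel] at this
  · convert h2 using 1
    symm
    have hper : ∀ i, Y (i % ((d * m : ℕ) : ℤ)) = Y i := per_emod Y hY
    have hkey : ∀ i : ℤ, Y i = false → 
        ∃ k : ℕ, k < m ∧ i % ((d * m : ℕ) : ℤ) = r + d * k := by
      intro i hi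
      have b1 := Int.emod_lt_of_pos i hnz
      have b2 := Int.emod_nonneg i hnz.ne'
      obtain ⟨v, hv⟩ := Int.eq_ofNat_of_zero_le b2
      have hYv : Y v = false := by rw [← hv, hper, hi]
      have b3 := dvd_add (hzz v hYv) hpr
      rw [sub_add_sub_cancel] at b3
      have b4 : v % d = r := by
        have := (Int.emod_emod_of_dvd (v : ℤ) (dvd_refl (d : ℤ)))
        have b5 := Int.emod_eq_emod_iff_emod_sub_eq_zero.2 (Int.emod_eq_zero_of_dvd b3)
        rw [Int.emod_eq_of_lt (a := (r : ℤ)) (by omega) (by omega)] at b5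
        exact_mod_cast b5
      refine ⟨v / d, ?_, ?_⟩
      · rw [Nat.div_lt_iff_lt_mul hd, mul_comm]
        have : (v : ℤ) < (d * m : ℕ) := by rw [hv] at b1; exact b1
        exact_mod_cast this
      · rw [hv, ← b4]; exact_mod_cast (Nat.mod_add_div v d).symm
    refine Finset.card_bij' 
      (fun u _ => (((p - 1 - (u : ℤ)) % ((d * m : ℕ) : ℤ)) / d).toNat)
      (fun k _ => ((p - 1 - ((r : ℤ) + d * (k : ℤ))) % ((d * m : ℕ) : ℤ)).toNat) ?_ ?_ ?_ ?_
    · intro u hu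
      simp only [Finset.mem_filter, Finset.mem_range] at hu ⊢
      obtain ⟨k, hk, e⟩ := hkey _ hu.2
      have e2 : ((r : ℤ) + d * k) / d = k := by
        rw [Int.add_mul_ediv_left _ _ hd0.ne', Int.ediv_eq_zero_of_lt (by omega) (by omega)]; simp
      rw [e, e2, Int.toNat_natCast]
      refine ⟨hk, ?_⟩
      rw [← e, hper, hu.2]
    · intro k hk
      simp only [Finset.mem_filter, Finset.mem_range] at hk ⊢
      have b1 := Int.emod_lt_of_pos (p - 1 - ((r : ℤ) + d * (k : ℤ))) hnz
      have b2 := Int.emod_nonneg (p - 1 - ((r : ℤ) + d * (k : ℤ))) hnz.ne'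
      refine ⟨by omega, ?_⟩
      rw [Int.toNat_of_nonneg b2, ← hper, Int.sub_emod_emod, hper, ← hk.2]
      congr 1; ring
    · intro u hu
      simp only [Finset.mem_filter, Finset.mem_range] at hu ⊢
      obtain ⟨k, hk, e⟩ := hkey _ hu.2
      have e2 : ((r : ℤ) + d * k) / d = k := by
        rw [Int.add_mul_ediv_left _ _ hd0.ne', Int.ediv_eq_zero_of_lt (by omega) (by omega)]; simp
      rw [e, e2, Int.toNat_natCast, ← e, Int.sub_emod_emod]
      have e3 : p - 1 - (p - 1 - (u : ℤ)) = u := by ring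
      rw [e3, Int.emod_eq_of_lt (by omega) (by exact_mod_cast hu.1)]; simp
    · intro k hk
      simp only [Finset.mem_filter, Finset.mem_range] at hk ⊢
      have b2 := Int.emod_nonneg (p - 1 - ((r : ℤ) + d * (k : ℤ))) hnz.ne'
      rw [Int.toNat_of_nonneg b2, Int.sub_emod_emod]
      have e3 : p - 1 - (p - 1 - ((r : ℤ) + d * (k : ℤ))) = r + d * k := by ring
      have hlt : r + d * k < d * m := by
        have : d * (k + 1) ≤ d * m := Nat.mul_le_mul_left _ hk.1
        rw [Nat.mul_succ] at this; omega
      rw [e3, Int.emod_eq_of_lt (by positivity) (by exact_mod_cast hlt),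
        Int.add_mul_ediv_left _ _ hd0.ne', Int.ediv_eq_zero_of_lt (by omega) (by omega)]; simp

lemma card_odd_powerset (m : ℕ) (hm : 0 < m) :
    ((Finset.range m).powerset.filter fun U => Odd U.card).card = 2 ^ (m - 1) := by
  have h0 := Finset.sum_powerset_neg_one_pow_card_of_nonempty (x := Finset.range m) ⟨0, by simpa⟩
  have h1 : ∑ U ∈ (Finset.range m).powerset, ((1 : ℤ) - (-1) ^ U.card) = 2 ^ m := by
    rw [Finset.sum_sub_distrib, h0]; simp
  have h2 : ∑ U ∈ (Finset.range m).powerset, ((1 : ℤ) - (-1) ^ U.card)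
      = ∑ U ∈ (Finset.range m).powerset, if Odd U.card then 2 else 0 := by
    apply Finset.sum_congr rfl
    intro U _
    split_ifs with h
    · rw [h.neg_one_pow]; norm_num
    · rw [(Nat.not_odd_iff_even.1 h).neg_one_pow]; norm_num
  rw [h2, ← Finset.sum_filter, Finset.sum_const] at h1
  obtain ⟨k, rfl⟩ : ∃ k, m = k + 1 := ⟨m - 1, by omega⟩
  rw [pow_succ, nsmul_eq_mul] at h1
  have := mul_right_cancel₀ (by norm_num) h1
  simpa using (by exact_mod_cast this :
    ((Finset.range (k + 1)).powerset.filter fun U => Odd U.card).card = 2 ^ k)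

open Classical in
lemma card_bad (d m : ℕ) (hd : 1 ≤ d) (hm : 0 < m) (hn : 0 < d * m) (r : ℕ) (hr : r < d) :
    (Finset.univ.filter fun y : Fin (d * m) → Bool => Bad d m (extZ hn y) r).card
      = 2 ^ (m - 1) := by
  rw [← card_odd_powerset m hm]
  have hd0 : (0 : ℤ) < d := by omega
  have hlt : ∀ k < m, r + d * k < d * m := by
    intro k hk
    have : d * (k + 1) ≤ d * m := Nat.mul_le_mul_left _ hk
    rw [Nat.mul_succ] at this; omega
  have hmod : ∀ v : ℕ, (d : ℤ) ∣ (v : ℤ) - r → v % d = r := by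
    intro v b3
    have b5 := Int.emod_eq_emod_iff_emod_sub_eq_zero.2 (Int.emod_eq_zero_of_dvd b3)
    rw [Int.emod_eq_of_lt (a := (r : ℤ)) (by omega) (by omega)] at b5
    exact_mod_cast b5
  refine Finset.card_bij 
    (fun y _ => (Finset.range m).filter fun k : ℕ => extZ hn y (r + d * k) = false) ?_ ?_ ?_
  · intro y hy
    simp only [Finset.mem_filter, Finset.mem_univ, true_and, Finset.mem_powerset] at hy ⊢
    exact ⟨Finset.filter_subset _ _, hy.2⟩
  · intro y hy y' hy' he
    simp only [Finset.mem_filter, Finset.mem_univ, true_and] at hy hy'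
    have hf : ∀ i : Fin (d * m), y i = false ↔ y' i = false := by
      intro i
      have e : ∀ w : Fin (d * m) → Bool, extZ hn w (i.val : ℤ) = w i := 
        fun w => extZ_nat hn w i i.isLt
      by_cases hi : i.val % d = r
      · have h1 := Finset.ext_iff.1 he (i.val / d)
        have h2 : (r : ℤ) + d * ((i.val / d : ℕ) : ℤ) = (i.val : ℤ) := by
          rw [← hi]; exact_mod_cast Nat.mod_add_div i.val d
        have h3 : i.val / d < m := by
          exact Nat.div_lt_of_lt_mul i.isLt
        simp only [Finset.mem_filter, Finset.mem_range, h2, e, h3, true_and] at h1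
        exact h1
      · constructor
        · intro h; exact absurd (hmod _ (hy.1 i.val (by rw [e, h]))) hi
        · intro h; exact absurd (hmod _ (hy'.1 i.val (by rw [e, h]))) hi
    funext i
    have := hf i
    revert this
    cases y i <;> cases y' i <;> simp
  · intro V hV
    simp only [Finset.mem_filter, Finset.mem_powerset] at hV
    set y : Fin (d * m) → Bool := fun i => !decide (i.val % d = r ∧ i.val / d ∈ V) with hy
    have hVe : ((Finset.range m).filter fun k : ℕ => extZ hn y (r + d * k) = false) = V := by
      ext k
      simp only [Finset.mem_filter, Finset.mem_range]
      have h1 : ∀ hk : k < m, extZ hn y (r + d * k) = y ⟨r + d * k, hlt k hk⟩ := by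
        intro hk
        rw [← extZ_nat hn y]; push_cast; rfl
      have h2 : (r + d * k) / d = k := by
        rw [Nat.add_mul_div_left _ _ hd, Nat.div_eq_of_lt hr, zero_add]
      have h3 : (r + d * k) % d = r := by
        rw [Nat.add_mul_mod_self_left, Nat.mod_eq_of_lt hr]
      constructor
      · rintro ⟨hk, h⟩
        rw [h1 hk] at h
        simp only [hy, h2, h3] at h
        simpa using h
      · intro hk
        have hk' := Finset.mem_range.1 (hV.1 hk)
        refine ⟨hk', ?_⟩
        rw [h1 hk']
        simp only [hy, h2, h3]
        simpa using hk
    refine ⟨y, ?_, hVe⟩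
    simp only [Finset.mem_filter, Finset.mem_univ, true_and]
    refine ⟨?_, by rw [hVe]; exact hV.2⟩
    intro i hi
    simp only [extZ, hy, Bool.not_eq_false', decide_eq_true_eq] at hi
    have hnz : (0 : ℤ) < ((d * m : ℕ) : ℤ) := by exact_mod_cast hn
    have a2 := Int.emod_nonneg i hnz.ne'
    have a3 : (i % ((d * m : ℕ) : ℤ)) % d = r := by
      rw [← Int.toNat_of_nonneg a2]; exact_mod_cast hi.1
    rw [Int.emod_emod_of_dvd _ (by push_cast; exact dvd_mul_right _ _)] at a3
    rw [← a3]; exact Int.dvd_self_sub_emod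

/-- The number of points with empty fiber under the cyclic map induced by
`x₁ ⊕ x₂⋯x_d(x_{d+1}⊕1)` is `d·2^{n/d-1}` if `d ∣ n` and `0` otherwise. -/
theorem stmt14 (d n : ℕ) (hd : 1 ≤ d) (hn : d < n) :
    (Finset.univ.filter fun y : Fin n → Bool =>
        ∀ x : Fin n → Bool, cyc (chiGen d) x ≠ y).card
      = if d ∣ n then d * 2 ^ (n / d - 1) else 0 := by
  classical
  have hn0 : 0 < n := by omega
  have hbad : ∀ y : Fin n → Bool, (∀ x : Fin n → Bool, cyc (chiGen d) x ≠ y) →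
      ∃ m, n = d * m ∧ ∃ r < d, Bad d m (extZ hn0 y) r := by
    intro y hy
    refine bad_of_no d n hd hn _ (extZ_per hn0 y) ?_
    intro X hX hpre
    refine hy (fun i => X i.val) ((cyc_iff d n hn0 _ _).2 ?_)
    have : extZ hn0 (fun i : Fin n => X i.val) = X := by
      funext i
      simp only [extZ]
      rw [Int.toNat_of_nonneg (Int.emod_nonneg i (by omega)), per_emod X hX]
    rw [this]; exact hpre
  split_ifs with hdn
  · obtain ⟨m, rfl⟩ := hdn
    have hm : 0 < m := Nat.pos_of_mul_pos_left hn0 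
    have hset : (Finset.univ.filter fun y : Fin (d * m) → Bool =>
        ∀ x : Fin (d * m) → Bool, cyc (chiGen d) x ≠ y) = 
        (Finset.range d).biUnion fun r => 
          Finset.univ.filter fun y : Fin (d * m) → Bool => Bad d m (extZ hn0 y) r := by
      ext y
      simp only [Finset.mem_filter, Finset.mem_univ, true_and, Finset.mem_biUnion,
        Finset.mem_range]
      constructor
      · intro hy
        obtain ⟨m', e, r, hr, hb⟩ := hbad y hy
        have : m' = m := (Nat.eq_of_mul_eq_mul_left (by omega) e).symm
        subst this
        exact ⟨r, hr, hb⟩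
      · rintro ⟨r, hr, h1, h2⟩ x hx
        exact no_pre d m (extZ hn0 x) (extZ hn0 y) (extZ_per hn0 x) r h1
          ((cyc_iff d _ hn0 x y).1 hx) h2
    rw [hset, Finset.card_biUnion, Finset.sum_congr rfl (fun r hr => 
      card_bad d m hd hm hn0 r (Finset.mem_range.1 hr))]
    · simp [Nat.mul_div_cancel_left m hd]
    · intro r hr r' hr' hne
      change Disjoint _ _
      rw [Finset.disjoint_left]
      intro y hy hy'
      simp only [Finset.mem_filter, Finset.mem_univ, true_and, Finset.coe_range,
        Set.mem_Iio] at hy hy' hr hr'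
      obtain ⟨k, hk⟩ := Finset.card_pos.1 hy.2.pos
      have h1 := hy'.1 _ (Finset.mem_filter.1 hk).2
      have h2 := hy.1 _ (Finset.mem_filter.1 hk).2
      have h3 := dvd_sub h1 h2
      rw [sub_sub_sub_cancel_left] at h3
      have h4 := Int.eq_zero_of_abs_lt_dvd h3 (by rw [abs_lt]; constructor <;> omega)
      omega
  · rw [Finset.card_eq_zero, Finset.filter_eq_empty_iff]
    intro y _ hy
    obtain ⟨m, e, _⟩ := hbad y hy
    exact hdn ⟨m, e⟩
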